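/- (Theorem 2, concurrence formula) Let Φ be a positive trace-preserving real-linear map on Hermitian 2×2 matrices, w ∈ ℝ, and suppose the real symmetric 4×4 matrix Q_w of the quadratic form q_w(x) = Φ(x)·Φ(x) − w x·x is positive semidefinite with nontrivial kernel containing a nonzero vector n with n·n ≤ 0. Then for every qubit state ρ with vector x, the concurrence satisfies C_Φ(ρ) = √(q_w(x)), and the infimum in the definition of C_Φ(ρ) is attained by a decomposition into at most two pure states. -/

import Mathlib

open scoped Matrix ComplexOrder
open Matrix

noncomputable section

/-- Pauli matrix σ₁ -/
def pauli1 : Matrix (Fin 2) (Fin 2) ℂ := !![0, 1; 1, 0]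
/-- Pauli matrix σ₂ -/
def pauli2 : Matrix (Fin 2) (Fin 2) ℂ := !![0, -Complex.I; Complex.I, 0]
/-- Pauli matrix σ₃ -/
def pauli3 : Matrix (Fin 2) (Fin 2) ℂ := !![1, 0; 0, -1]

/-- The map x ↦ ½(x₀ I + x₁σ₁ + x₂σ₂ + x₃σ₃). -/
def toMat (x : Fin 4 → ℝ) : Matrix (Fin 2) (Fin 2) ℂ :=
  (1 / 2 : ℂ) • ((x 0 : ℂ) • (1 : Matrix (Fin 2) (Fin 2) ℂ) +
    (x 1 : ℂ) • pauli1 + (x 2 : ℂ) • pauli2 + (x 3 : ℂ) • pauli3)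

/-- Minkowski inner product on ℝ⁴. -/
def mink (x y : Fin 4 → ℝ) : ℝ := x 0 * y 0 - x 1 * y 1 - x 2 * y 2 - x 3 * y 3

/-- Bloch-picture action of a trace-preserving linear map:
(x₀, x⃗) ↦ (x₀, x₀ t⃗ + Λ x⃗). -/
def phiVec (t : Fin 3 → ℝ) (Λ : Matrix (Fin 3) (Fin 3) ℝ) (x : Fin 4 → ℝ) : Fin 4 → ℝ :=
  ![x 0,
    x 0 * t 0 + ∑ j : Fin 3, Λ 0 j * x j.succ,
    x 0 * t 1 + ∑ j : Fin 3, Λ 1 j * x j.succ,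
    x 0 * t 2 + ∑ j : Fin 3, Λ 2 j * x j.succ]

/-- The quadratic form q_w(x) = Φ(x)·Φ(x) − w x·x. -/
def qform (t : Fin 3 → ℝ) (Λ : Matrix (Fin 3) (Fin 3) ℝ) (w : ℝ) (x : Fin 4 → ℝ) : ℝ :=
  mink (phiVec t Λ x) (phiVec t Λ x) - w * mink x x

/-- Positivity of the map in the Bloch picture: positive semidefinite matrices are
mapped to positive semidefinite matrices. -/
def IsPosMap (t : Fin 3 → ℝ) (Λ : Matrix (Fin 3) (Fin 3) ℝ) : Prop :=
  ∀ x : Fin 4 → ℝ, (toMat x).PosSemidef → (toMat (phiVec t Λ x)).PosSemidef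

/-- x is the Bloch vector of a qubit state. -/
def IsStateVec (x : Fin 4 → ℝ) : Prop := (toMat x).PosSemidef ∧ x 0 = 1

/-- x is the Bloch vector of a pure qubit state (determinant zero, i.e. x·x = 0). -/
def IsPureVec (x : Fin 4 → ℝ) : Prop := (toMat x).PosSemidef ∧ x 0 = 1 ∧ mink x x = 0

/-- Concurrence of a pure state: C_Φ(π) = 2√(det Φ(π)). -/
def pureConc (t : Fin 3 → ℝ) (Λ : Matrix (Fin 3) (Fin 3) ℝ) (y : Fin 4 → ℝ) : ℝ :=
  2 * Real.sqrt ((toMat (phiVec t Λ y)).det.re)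

/-- Concurrence of a (mixed) state with Bloch vector x: the infimum over finite
convex decompositions into pure states of the average pure-state concurrence. -/
def conc (t : Fin 3 → ℝ) (Λ : Matrix (Fin 3) (Fin 3) ℝ) (x : Fin 4 → ℝ) : ℝ :=
  sInf {c : ℝ | ∃ (k : ℕ) (p : Fin k → ℝ) (y : Fin k → (Fin 4 → ℝ)),
    (∀ j, 0 < p j) ∧ (∑ j, p j) = 1 ∧ (∀ j, IsPureVec (y j)) ∧
    (∀ i, (∑ j, p j * y j i) = x i) ∧ c = ∑ j, p j * pureConc t Λ (y j)}

end

lemma det_toMat_re (x : Fin 4 → ℝ) : (toMat x).det.re = mink x x / 4 := by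
  simp [toMat, pauli1, pauli2, pauli3, mink, Matrix.det_fin_two]
  ring

lemma mink_self_nonneg_of_posSemidef {x : Fin 4 → ℝ} (hx : (toMat x).PosSemidef) :
    0 ≤ mink x x := by
  have h := (Complex.le_def.1 hx.det_nonneg).1
  rw [det_toMat_re] at h
  simp only [Complex.zero_re] at h
  linarith

lemma toMat_isHermitian (x : Fin 4 → ℝ) : (toMat x).IsHermitian := by
  ext i j
  fin_cases i <;> fin_cases j <;>
    simp [toMat, pauli1, pauli2, pauli3, Matrix.conjTranspose_apply] <;>
    ring

lemma toMat_mul_self {y : Fin 4 → ℝ} (h0 : y 0 = 1) (hy : mink y y = 0) :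
    toMat y * toMat y = toMat y := by
  have h : y 1 * y 1 + y 2 * y 2 + y 3 * y 3 = 1 := by
    simp only [mink, h0] at hy
    linarith
  ext i j
  fin_cases i <;> fin_cases j <;>
    apply Complex.ext <;>
    simp [toMat, pauli1, pauli2, pauli3, Matrix.mul_apply, Fin.sum_univ_two, h0] <;>
    linarith

lemma isPureVec_of_mink_self_eq_zero {y : Fin 4 → ℝ} (h0 : y 0 = 1) (hy : mink y y = 0) :
    IsPureVec y := by
  refine ⟨?_, h0, hy⟩
  rw [← toMat_mul_self h0 hy]
  nth_rewrite 1 [← (toMat_isHermitian y).eq]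
  exact Matrix.posSemidef_conjTranspose_mul_self _

lemma pureConc_eq_sqrt_qform (t : Fin 3 → ℝ) (Λ : Matrix (Fin 3) (Fin 3) ℝ) (w : ℝ)
    {y : Fin 4 → ℝ} (hy : mink y y = 0) :
    pureConc t Λ y = √(qform t Λ w y) := by
  rw [pureConc, det_toMat_re, qform, hy, mul_zero, sub_zero, Real.sqrt_div' _ (by norm_num),
    show (4 : ℝ) = 2 ^ 2 by norm_num, Real.sqrt_sq (by norm_num)]
  ring

lemma mink_add_smul_self (x n : Fin 4 → ℝ) (s : ℝ) :
    mink (x + s • n) (x + s • n) = mink n n * s ^ 2 + 2 * mink x n * s + mink x x := by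
  simp only [mink, Pi.add_apply, Pi.smul_apply, smul_eq_mul]
  ring

lemma mink_add_smul_right (x n : Fin 4 → ℝ) (s : ℝ) :
    mink x (x + s • n) = mink x x + s * mink x n := by
  simp only [mink, Pi.add_apply, Pi.smul_apply, smul_eq_mul]
  ring

lemma mink_smul_self (n : Fin 4 → ℝ) (s : ℝ) : mink (s • n) (s • n) = s ^ 2 * mink n n := by
  simp only [mink, Pi.smul_apply, smul_eq_mul]
  ring

lemma mink_neg_right (x n : Fin 4 → ℝ) : mink x (-n) = -mink x n := by
  simp only [mink, Pi.neg_apply]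
  ring

lemma mink_neg_self (n : Fin 4 → ℝ) : mink (-n) (-n) = mink n n := by
  simp only [mink, Pi.neg_apply]
  ring

lemma sq_spatial_le (x y : Fin 4 → ℝ) :
    (x 1 * y 1 + x 2 * y 2 + x 3 * y 3) ^ 2 ≤
      (x 1 ^ 2 + x 2 ^ 2 + x 3 ^ 2) * (y 1 ^ 2 + y 2 ^ 2 + y 3 ^ 2) := by
  nlinarith [sq_nonneg (x 1 * y 2 - x 2 * y 1), sq_nonneg (x 1 * y 3 - x 3 * y 1),
    sq_nonneg (x 2 * y 3 - x 3 * y 2)]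

/-- A null vector whose product with a forward timelike vector is positive is itself forward. -/
lemma time_pos_of_mink_pos {x y : Fin 4 → ℝ} (h0 : x 0 = 1) (hx : 0 < mink x x)
    (hy : mink y y = 0) (hxy : 0 < mink x y) : 0 < y 0 := by
  by_contra! h
  have hcs := sq_spatial_le x y
  simp only [mink, h0, one_mul] at hx hy hxy
  have hY : y 1 ^ 2 + y 2 ^ 2 + y 3 ^ 2 = y 0 ^ 2 := by linarith
  have hX : x 1 ^ 2 + x 2 ^ 2 + x 3 ^ 2 ≤ 1 := by linarith
  rw [hY] at hcs
  nlinarith [mul_le_mul_of_nonneg_right hX (sq_nonneg (y 0))]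

/-- A vector that is null and orthogonal to a timelike vector vanishes. -/
lemma eq_zero_of_mink_eq_zero {x n : Fin 4 → ℝ} (h0 : x 0 = 1) (hx : 0 < mink x x)
    (hn : mink n n = 0) (hxn : mink x n = 0) : n = 0 := by
  have hcs := sq_spatial_le x n
  simp only [mink, h0, one_mul] at hx hn hxn
  have hN : n 1 ^ 2 + n 2 ^ 2 + n 3 ^ 2 = n 0 ^ 2 := by linarith
  have hB : x 1 * n 1 + x 2 * n 2 + x 3 * n 3 = n 0 := by linarith
  rw [hN, hB] at hcs
  have hz : n 0 = 0 := by
    by_contra h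
    have := sq_pos_of_ne_zero h
    nlinarith
  rw [hz] at hN
  ext i
  fin_cases i
  · exact hz
  all_goals
    simp only [Pi.zero_apply]
    exact pow_eq_zero_iff two_ne_zero |>.1 (le_antisymm
      (by simp; nlinarith [sq_nonneg (n 1), sq_nonneg (n 2), sq_nonneg (n 3)]) (sq_nonneg _))

/-- A quadratic with negative leading and positive constant coefficient has roots of both signs. -/
lemma exists_roots_of_neg_of_pos {A B C : ℝ} (hA : A < 0) (hC : 0 < C) :
    ∃ r s : ℝ, r < 0 ∧ 0 < s ∧ A * r ^ 2 + 2 * B * r + C = 0 ∧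
      A * s ^ 2 + 2 * B * s + C = 0 := by
  have hAC : 0 < -(A * C) := by nlinarith
  have hD : 0 ≤ B ^ 2 - A * C := by nlinarith [sq_nonneg B]
  have hsq := Real.sq_sqrt hD
  have hlt : |B| < √(B ^ 2 - A * C) := by
    rw [← Real.sqrt_sq_eq_abs]
    exact Real.sqrt_lt_sqrt (sq_nonneg B) (by linarith)
  obtain ⟨h1, h2⟩ := abs_lt.1 hlt
  set d := √(B ^ 2 - A * C)
  have hA' := hA.ne
  refine ⟨(-B + d) / A, (-B - d) / A, div_neg_of_pos_of_neg (by linarith) hA,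
    div_pos_of_neg_of_neg (by linarith) hA, ?_, ?_⟩ <;>
  · field_simp
    nlinarith

/-- Rescales a decomposition into forward null vectors to one into pure states. -/
lemma exists_pure_of_null {E : Type*} [NormedAddCommGroup E] [NormedSpace ℝ E]
    {x y z : Fin 4 → ℝ} {a b : ℝ} (L : (Fin 4 → ℝ) →ₗ[ℝ] E)
    (h0 : x 0 = 1) (hx : 0 < mink x x) (ha : 0 < a) (hb : 0 < b)
    (hy : mink y y = 0) (hz : mink z z = 0) (hxy : 0 < mink x y) (hxz : 0 < mink x z)
    (hsum : x = a • y + b • z) (hL : ‖L x‖ = a * ‖L y‖ + b * ‖L z‖) :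
    ∃ (p : ℝ) (u v : Fin 4 → ℝ), 0 < p ∧ p < 1 ∧ IsPureVec u ∧ IsPureVec v ∧
      x = p • u + (1 - p) • v ∧ ‖L x‖ = p * ‖L u‖ + (1 - p) * ‖L v‖ := by
  have hy0 := time_pos_of_mink_pos h0 hx hy hxy
  have hz0 := time_pos_of_mink_pos h0 hx hz hxz
  have h1 : a * y 0 + b * z 0 = 1 := by
    have := congrFun hsum 0
    simp only [h0, Pi.add_apply, Pi.smul_apply, smul_eq_mul] at this
    exact this.symm
  have hq : 1 - a * y 0 = b * z 0 := by linarith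
  have hbz := mul_pos hb hz0
  refine ⟨a * y 0, (y 0)⁻¹ • y, (z 0)⁻¹ • z, mul_pos ha hy0, by linarith,
    isPureVec_of_mink_self_eq_zero (by simp [hy0.ne']) (by simp [mink_smul_self, hy]),
    isPureVec_of_mink_self_eq_zero (by simp [hz0.ne']) (by simp [mink_smul_self, hz]), ?_, ?_⟩
  · rw [hq, smul_smul, smul_smul, mul_assoc, mul_assoc, mul_inv_cancel₀ hy0.ne',
      mul_inv_cancel₀ hz0.ne', mul_one, mul_one]
    exact hsum
  · rw [hq, hL, map_smul, map_smul, norm_smul, norm_smul, norm_inv, norm_inv,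
      Real.norm_of_nonneg hy0.le, Real.norm_of_nonneg hz0.le]
    field_simp

lemma exists_pure_decomposition {E : Type*} [NormedAddCommGroup E] [NormedSpace ℝ E]
    {x n : Fin 4 → ℝ} (L : (Fin 4 → ℝ) →ₗ[ℝ] E)
    (h0 : x 0 = 1) (hx : 0 < mink x x) (hn : n ≠ 0) (hnn : mink n n ≤ 0) (hLn : L n = 0) :
    ∃ (p : ℝ) (u v : Fin 4 → ℝ), 0 < p ∧ p < 1 ∧ IsPureVec u ∧ IsPureVec v ∧
      x = p • u + (1 - p) • v ∧ ‖L x‖ = p * ‖L u‖ + (1 - p) * ‖L v‖ := by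
  have hforward : ∀ s, mink n n * s ^ 2 + 2 * mink x n * s + mink x x = 0 →
      0 < mink x (x + s • n) := by
    intro s hs
    rw [mink_add_smul_right]
    nlinarith [mul_nonneg (neg_nonneg.2 hnn) (sq_nonneg s)]
  rcases hnn.lt_or_eq with hneg | hnull
  · obtain ⟨r, s, hr, hs, hr', hs'⟩ := exists_roots_of_neg_of_pos (B := mink x n) hneg hx
    have hsr : 0 < s - r := by linarith
    refine exists_pure_of_null (y := x + r • n) (z := x + s • n) (a := s / (s - r))
      (b := -r / (s - r)) L h0 hx (div_pos hs hsr) (div_pos (by linarith) hsr)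
      (by rw [mink_add_smul_self, hr']) (by rw [mink_add_smul_self, hs'])
      (hforward r hr') (hforward s hs') ?_ ?_
    · ext i
      simp only [Pi.add_apply, Pi.smul_apply, smul_eq_mul]
      field_simp
      ring
    · simp only [map_add, map_smul, hLn, smul_zero, add_zero]
      field_simp
      ring
  · wlog hpos : 0 < mink x n generalizing n
    · refine this (n := -n) (neg_ne_zero.2 hn) (by rwa [mink_neg_self]) (by simp [hLn]) ?_
        (by rwa [mink_neg_self]) ?_
      · intro s hs
        simpa using hforward (-s) (by
          rw [mink_neg_self, mink_neg_right] at hs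
          linarith)
      · rw [mink_neg_right]
        have : mink x n ≠ 0 := fun h => hn (eq_zero_of_mink_eq_zero h0 hx hnull h)
        have := lt_of_le_of_ne (not_lt.1 hpos) this
        linarith
    have hs : mink n n * (-(mink x x / (2 * mink x n))) ^ 2 +
        2 * mink x n * (-(mink x x / (2 * mink x n))) + mink x x = 0 := by
      rw [hnull]
      field_simp
      ring
    refine exists_pure_of_null (y := x + (-(mink x x / (2 * mink x n))) • n) (z := n) (a := 1)
      (b := mink x x / (2 * mink x n)) L h0 hx one_pos (by positivity)
      (by rw [mink_add_smul_self, hs]) hnull (hforward _ hs) hpos ?_ ?_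
    · simp
    · simp [hLn]

open scoped MatrixOrder Matrix.Norms.L2Operator in
/-- A positive semidefinite quadratic form is the square of a Euclidean seminorm. -/
lemma exists_linearMap_sqrt_eq_norm {Q : Matrix (Fin 4) (Fin 4) ℝ} (hQ : Q.PosSemidef) :
    ∃ L : (Fin 4 → ℝ) →ₗ[ℝ] EuclideanSpace ℝ (Fin 4), ∀ x, √(x ⬝ᵥ Q.mulVec x) = ‖L x‖ := by
  obtain ⟨B, rfl⟩ := CStarAlgebra.nonneg_iff_eq_star_mul_self.1 hQ.nonneg
  refine ⟨(WithLp.linearEquiv 2 ℝ (Fin 4 → ℝ)).symm.toLinearMap ∘ₗ B.mulVecLin, fun x => ?_⟩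
  rw [EuclideanSpace.norm_eq, Matrix.star_eq_conjTranspose,
    ← Matrix.mulVec_mulVec, Matrix.dotProduct_mulVec,
    Matrix.conjTranspose_eq_transpose_of_trivial, Matrix.vecMul_transpose]
  simp [dotProduct, sq]

/-- Theorem 2, concurrence formula: if Q_w is positive semidefinite with
a nonzero kernel vector n with n·n ≤ 0, then the concurrence of every qubit state with
vector x is C_Φ(ρ) = √(q_w(x)), and the infimum defining C_Φ is attained by a
decomposition into at most two pure states. -/
theorem stmt8 (t : Fin 3 → ℝ) (Λ : Matrix (Fin 3) (Fin 3) ℝ) (hpos : IsPosMap t Λ)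
    (w : ℝ) (Q : Matrix (Fin 4) (Fin 4) ℝ) (hsymm : Q.IsSymm)
    (hrepr : ∀ y : Fin 4 → ℝ, y ⬝ᵥ Q.mulVec y = qform t Λ w y)
    (hpsd : Q.PosSemidef)
    (n : Fin 4 → ℝ) (hn : n ≠ 0) (hker : Q.mulVec n = 0) (hnn : mink n n ≤ 0)
    (x : Fin 4 → ℝ) (hx : IsStateVec x) :
    conc t Λ x = Real.sqrt (qform t Λ w x) ∧
    ∃ (p : ℝ) (y z : Fin 4 → ℝ), 0 ≤ p ∧ p ≤ 1 ∧
      IsPureVec y ∧ IsPureVec z ∧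
      x = p • y + (1 - p) • z ∧
      conc t Λ x = p * pureConc t Λ y + (1 - p) * pureConc t Λ z := by
  obtain ⟨L, hL⟩ := exists_linearMap_sqrt_eq_norm hpsd
  have hsqrt : ∀ y, √(qform t Λ w y) = ‖L y‖ := fun y => by rw [← hrepr, hL]
  have hpure : ∀ y, IsPureVec y → pureConc t Λ y = ‖L y‖ := fun y hy => by
    rw [pureConc_eq_sqrt_qform t Λ w hy.2.2, hsqrt]
  have hLn : L n = 0 := by
    rw [← norm_eq_zero, ← hL, hker, dotProduct_zero, Real.sqrt_zero]
  have hdec : ∃ (p : ℝ) (y z : Fin 4 → ℝ), 0 ≤ p ∧ p ≤ 1 ∧ IsPureVec y ∧ IsPureVec z ∧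
      x = p • y + (1 - p) • z ∧ ‖L x‖ = p * ‖L y‖ + (1 - p) * ‖L z‖ ∧ (p = 1 ∨ p < 1 ∧ 0 < p) := by
    rcases (mink_self_nonneg_of_posSemidef hx.1).eq_or_lt with h | h
    · exact ⟨1, x, x, zero_le_one, le_rfl, ⟨hx.1, hx.2, h.symm⟩, ⟨hx.1, hx.2, h.symm⟩,
        by simp, by simp, Or.inl rfl⟩
    · obtain ⟨p, y, z, hp, hp1, hy, hz, hxyz, hN⟩ :=
        exists_pure_decomposition L hx.2 h hn hnn hLn
      exact ⟨p, y, z, hp.le, hp1.le, hy, hz, hxyz, hN, Or.inr ⟨hp1, hp⟩⟩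
  obtain ⟨p, y, z, hp0, hp1, hy, hz, hxyz, hN, hp⟩ := hdec
  have hconc : conc t Λ x = ‖L x‖ := by
    refine IsLeast.csInf_eq ⟨?_, ?_⟩
    · rcases hp with rfl | ⟨hlt, hpos⟩
      · refine ⟨1, fun _ => 1, fun _ => y, by simp, by simp, fun _ => hy, ?_, ?_⟩
        · simp [hxyz]
        · simp [hpure y hy, hN]
      · refine ⟨2, ![p, 1 - p], ![y, z], ?_, by simp, ?_, ?_, ?_⟩
        · simp [Fin.forall_fin_two, hlt, hpos]
        · simp [Fin.forall_fin_two, hy, hz]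
        · simp [hxyz]
        · simp [hpure y hy, hpure z hz, hN]
    · rintro c ⟨k, q, v, hq, -, hv, hsum, rfl⟩
      have hxv : x = ∑ j, q j • v j := by
        ext i
        simp [Finset.sum_apply, hsum i]
      rw [hxv, map_sum]
      refine (norm_sum_le _ _).trans (Finset.sum_le_sum fun j _ => ?_)
      rw [map_smul, norm_smul, Real.norm_of_nonneg (hq j).le, hpure _ (hv j)]
  refine ⟨by rw [hconc, hsqrt], p, y, z, hp0, hp1, hy, hz, hxyz, ?_⟩
  rw [hconc, hpure y hy, hpure z hz, hN]
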